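/- arXiv:1407.3972 — 6 statements merged into one kernel-verified Lean document; each statement's English description precedes it below -/
import Mathlib

section
/- Let n ≥ 2 and l ≥ 1 be integers. For every real number y > 0 the following identity holds: n·y^{n+2l} − (n+2l)·y^n + 2l = (y−1)^2 · ( n·Σ_{j=2}^{2l} (j−1)·y^{n+2l−j} + 2l·Σ_{j=1}^{n} (n−j+1)·y^{n−j} ). -/
open Finset

theorem sub_one_sq_mul_sum_Icc_two {R : Type*} [CommRing R] (y : R) (n m : ℕ) :
    (y - 1) ^ 2 * ∑ j ∈ Finset.Icc 2 (m + 1), ((j : R) - 1) * y ^ (n + (m + 1) - j) =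
      y ^ n * (y ^ (m + 1) - (m + 1) * y + m) := by
  induction m with
  | zero => simp
  | succ m ih =>
    have h : ∑ j ∈ Finset.Icc 2 (m + 1), ((j : R) - 1) * y ^ (n + (m + 1 + 1) - j) =
        y * ∑ j ∈ Finset.Icc 2 (m + 1), ((j : R) - 1) * y ^ (n + (m + 1) - j) := by
      rw [Finset.mul_sum]
      refine Finset.sum_congr rfl fun j hj => ?_
      have hj' := (Finset.mem_Icc.mp hj).2
      rw [show n + (m + 1 + 1) - j = n + (m + 1) - j + 1 by omega]
      ring
    rw [Finset.sum_Icc_succ_top (by omega), h, mul_add, mul_left_comm, ih, Nat.add_sub_cancel]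
    push_cast
    ring

theorem sub_one_sq_mul_sum_range {R : Type*} [CommRing R] (y : R) (n : ℕ) :
    (y - 1) ^ 2 * ∑ k ∈ Finset.range n, ((k : R) + 1) * y ^ k =
      n * y ^ (n + 1) - (n + 1) * y ^ n + 1 := by
  induction n with
  | zero => simp
  | succ n ih =>
    rw [Finset.sum_range_succ, mul_add, ih]
    push_cast
    ring

theorem sum_Icc_one_eq_sum_range {R : Type*} [CommRing R] (y : R) (n : ℕ) :
    ∑ j ∈ Finset.Icc 1 n, ((n : R) - (j : R) + 1) * y ^ (n - j) =
      ∑ k ∈ Finset.range n, ((k : R) + 1) * y ^ k := by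
  refine Finset.sum_nbij' (fun j => n - j) (fun k => n - k) ?_ ?_ ?_ ?_ ?_
  · intro j hj
    simp only [Finset.mem_Icc, Finset.mem_range] at *
    omega
  · intro k hk
    simp only [Finset.mem_Icc, Finset.mem_range] at *
    omega
  · intro j hj
    simp only [Finset.mem_Icc] at *
    omega
  · intro k hk
    simp only [Finset.mem_range] at *
    omega
  · intro j hj
    rw [Nat.cast_sub (Finset.mem_Icc.mp hj).2]

/-- The algebraic factorization identity used in the proof of the polynomial
inequality (Lemma 3.1): for integers `n ≥ 2`, `l ≥ 1` and every real `y > 0`,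
`n·y^(n+2l) − (n+2l)·y^n + 2l
  = (y−1)^2 · (n·∑_{j=2}^{2l} (j−1)·y^(n+2l−j) + 2l·∑_{j=1}^{n} (n−j+1)·y^(n−j))`. -/
theorem stmt_0 (n l : ℕ) (hn : 2 ≤ n) (hl : 1 ≤ l) (y : ℝ) (hy : 0 < y) :
    (n : ℝ) * y ^ (n + 2 * l) - ((n : ℝ) + 2 * l) * y ^ n + 2 * l =
      (y - 1) ^ 2 *
        ((n : ℝ) * ∑ j ∈ Finset.Icc 2 (2 * l), ((j : ℝ) - 1) * y ^ (n + 2 * l - j)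
          + 2 * (l : ℝ) * ∑ j ∈ Finset.Icc 1 n, ((n : ℝ) - (j : ℝ) + 1) * y ^ (n - j)) := by
  obtain ⟨m, hm⟩ : ∃ m, 2 * l = m + 1 := ⟨2 * l - 1, by omega⟩
  have hm' : 2 * (l : ℝ) = m + 1 := by exact_mod_cast hm
  rw [hm, hm', mul_add, mul_left_comm, sub_one_sq_mul_sum_Icc_two,
    mul_left_comm (_ ^ 2) ((m : ℝ) + 1),
    sum_Icc_one_eq_sum_range, sub_one_sq_mul_sum_range]
  ring
end

section
/- Let n ≥ 2 and l ≥ 1 be integers. For all positive real numbers s and t one has n·t^{n+2l} − (n+2l)·t^n·s^{2l} + 2l·s^{n+2l} ≥ (2l·s^{n+2l−2} + 4l·t·s^{n+2l−3})·(s−t)^2. -/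
theorem sub_mul_pow_sub_pow_nonneg {s t : ℝ} (hs : 0 ≤ s) (ht : 0 ≤ t) (m : ℕ) :
    0 ≤ (t - s) * (t ^ m - s ^ m) := by
  rcases le_total s t with h | h
  · exact mul_nonneg (sub_nonneg.2 h) (sub_nonneg.2 (pow_le_pow_left₀ hs h m))
  · exact mul_nonneg_of_nonpos_of_nonpos (sub_nonpos.2 h)
      (sub_nonpos.2 (pow_le_pow_left₀ ht h m))

/-- A homogeneous form of Bernoulli's inequality. -/
theorem pow_succ_sub_mul_add_nonneg {s t : ℝ} (hs : 0 ≤ s) (ht : 0 ≤ t) (m : ℕ) :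
    0 ≤ t ^ (m + 1) - (m + 1) * t * s ^ m + m * s ^ (m + 1) := by
  induction m with
  | zero => simp
  | succ m ih =>
    have h₁ := mul_nonneg hs ih
    have h₂ := sub_mul_pow_sub_pow_nonneg hs ht (m + 1)
    push_cast
    linear_combination h₁ + h₂

theorem weighted_amgm_remainder {s t : ℝ} (hs : 0 ≤ s) (ht : 0 ≤ t) (p k : ℕ) :
    (k + 1) * s ^ (p + k) * (s + 2 * t) * (s - t) ^ 2 ≤
      (p + 2) * t ^ (p + k + 3) - (p + k + 3) * t ^ (p + 2) * s ^ (k + 1)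
        + (k + 1) * s ^ (p + k + 3) := by
  induction p with
  | zero =>
    have h := mul_nonneg (sq_nonneg t) (pow_succ_sub_mul_add_nonneg hs ht k)
    simp only [Nat.cast_zero, zero_add]
    linear_combination 2 * h
  | succ p ih =>
    have h₁ := mul_le_mul_of_nonneg_left ih hs
    have h₂ := mul_nonneg (pow_nonneg ht (p + 2)) (pow_succ_sub_mul_add_nonneg hs ht (k + 1))
    have h₃ := mul_nonneg (mul_nonneg (by positivity : (0 : ℝ) ≤ p + 2) (pow_nonneg ht (p + 2)))
      (sub_mul_pow_sub_pow_nonneg hs ht (k + 1))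
    push_cast at h₂ ⊢
    linear_combination h₁ + h₂ + h₃

/-- Lemma 3.1 of the paper: for integers `n ≥ 2`, `l ≥ 1` and all positive reals `s, t`,
`n·t^(n+2l) − (n+2l)·t^n·s^(2l) + 2l·s^(n+2l) ≥ (2l·s^(n+2l−2) + 4l·t·s^(n+2l−3))·(s−t)^2`. -/
theorem stmt_1 (n l : ℕ) (hn : 2 ≤ n) (hl : 1 ≤ l) (s t : ℝ) (hs : 0 < s) (ht : 0 < t) :
    (n : ℝ) * t ^ (n + 2 * l) - ((n : ℝ) + 2 * l) * t ^ n * s ^ (2 * l)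
        + 2 * (l : ℝ) * s ^ (n + 2 * l) ≥
      (2 * (l : ℝ) * s ^ (n + 2 * l - 2) + 4 * (l : ℝ) * t * s ^ (n + 2 * l - 3))
        * (s - t) ^ 2 := by
  obtain ⟨p, rfl⟩ := Nat.exists_eq_add_of_le' hn
  obtain ⟨j, rfl⟩ := Nat.exists_eq_add_of_le' hl
  have h := weighted_amgm_remainder hs.le ht.le p (2 * j + 1)
  rw [show p + 2 + 2 * (j + 1) - 2 = p + 2 * j + 2 by omega,
    show p + 2 + 2 * (j + 1) - 3 = p + 2 * j + 1 by omega]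
  push_cast at h ⊢
  linear_combination h
end

section
/- Let n ≥ 2 and l ≥ 1 be integers and let β : [0,∞) → [0,1] be a measurable function satisfying ∫_0^∞ β(t) dt = 1, ∫_0^∞ t^n β(t) dt < ∞ and ∫_0^∞ t^{n+2l} β(t) dt < ∞. Then there exists δ ≥ 0 such that ∫_δ^{δ+1} t^n dt = ∫_0^∞ t^n β(t) dt and ∫_δ^{δ+1} t^{n+2l} dt ≤ ∫_0^∞ t^{n+2l} β(t) dt. -/
open MeasureTheory Set intervalIntegral

/-- If `φ ≤ 0` on a unit interval and `φ ≥ 0` elsewhere on the half-line, then among densities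
bounded by one, the indicator of that interval has the smallest integral against `φ`. -/
theorem intervalIntegral_le_setIntegral_mul_of_sign {β φ : ℝ → ℝ} {δ : ℝ} (hδ : 0 ≤ δ)
    (hβ0 : ∀ t, 0 ≤ t → 0 ≤ β t) (hβ1 : ∀ t, 0 ≤ t → β t ≤ 1)
    (hφ : Continuous φ) (hint : IntegrableOn (fun t => φ t * β t) (Ioi (0 : ℝ)))
    (hneg : ∀ t ∈ Ioc δ (δ + 1), φ t ≤ 0)
    (hpos : ∀ t, 0 < t → t ∉ Ioc δ (δ + 1) → 0 ≤ φ t) :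
    (∫ t in δ..(δ + 1), φ t) ≤ ∫ t in Ioi (0 : ℝ), φ t * β t := by
  have hsub : Ioc δ (δ + 1) ⊆ Ioi (0 : ℝ) := fun t ht => lt_of_le_of_lt hδ ht.1
  have hφI : IntegrableOn φ (Ioc δ (δ + 1)) :=
    (intervalIntegrable_iff_integrableOn_Ioc_of_le (by linarith)).1 (hφ.intervalIntegrable _ _)
  have key : (∫ t in Ioi (0 : ℝ), (Ioc δ (δ + 1)).indicator φ t)
      = ∫ t in δ..(δ + 1), φ t := by
    rw [setIntegral_indicator measurableSet_Ioc, inter_eq_right.2 hsub,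
      integral_of_le (by linarith)]
  rw [← key]
  refine setIntegral_mono_on ((hφI.integrable_indicator measurableSet_Ioc).integrableOn) hint
    measurableSet_Ioi fun t ht => ?_
  have ht0 : 0 < t := ht
  by_cases h : t ∈ Ioc δ (δ + 1)
  · rw [indicator_of_mem h]
    nlinarith [hneg t h, hβ1 t ht0.le]
  · rw [indicator_of_notMem h]
    exact mul_nonneg (hpos t ht0 h) (hβ0 t ht0.le)

/-- Inside an interval a convex function lies below the chord, outside above it. -/
theorem ConvexOn.chord_sign {s : Set ℝ} {g : ℝ → ℝ} (hg : ConvexOn ℝ s g) {a b x : ℝ}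
    (ha : a ∈ s) (hb : b ∈ s) (hx : x ∈ s) (hab : a < b) :
    (a < x → x ≤ b → g x - g a ≤ (g b - g a) / (b - a) * (x - a)) ∧
    (x ≤ a ∨ b < x → (g b - g a) / (b - a) * (x - a) ≤ g x - g a) := by
  refine ⟨fun h1 h2 => ?_, ?_⟩
  · exact (div_le_iff₀ (sub_pos.2 h1)).1 (hg.secant_mono ha hx hb h1.ne' hab.ne' h2)
  · rintro (h | h)
    · rcases h.eq_or_lt with rfl | h
      · simp
      · have := hg.secant_mono ha hx hb h.ne hab.ne' (h.trans hab).le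
        exact (div_le_iff_of_neg (sub_neg.2 h)).1 this
    · have hax := hab.trans h
      exact (le_div_iff₀ (sub_pos.2 hax)).1 (hg.secant_mono ha hb hx hab.ne' hax.ne' h.le)

/-- Some unit interval in the half-line has a prescribed moment, provided this moment is at least
that of `[0, 1]`. -/
theorem exists_intervalIntegral_pow_eq {n : ℕ} (hn : n ≠ 0) {M : ℝ}
    (hM : (∫ t in (0 : ℝ)..(0 + 1), t ^ n) ≤ M) :
    ∃ δ : ℝ, 0 ≤ δ ∧ (∫ t in δ..(δ + 1), t ^ n) = M := by
  set F : ℝ → ℝ := fun δ => ∫ t in δ..(δ + 1), t ^ n with hF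
  have hcont : Continuous F := by
    have : F = fun δ : ℝ => ((δ + 1) ^ (n + 1) - δ ^ (n + 1)) / (n + 1) := by
      funext δ
      simp [hF, integral_pow]
    rw [this]
    fun_prop
  have hR : (1 : ℝ) ≤ max 1 M := le_max_left _ _
  have hlarge : M ≤ F (max 1 M) := by
    have h : (∫ _ in (max 1 M)..(max 1 M + 1), max 1 M) ≤ F (max 1 M) := by
      refine integral_mono_on (by linarith) (by simp)
        ((continuous_pow n).intervalIntegrable _ _) fun t ht => ?_
      exact ht.1.trans (le_self_pow₀ (hR.trans ht.1) hn)
    rw [intervalIntegral.integral_const] at h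
    simp only [add_sub_cancel_left, one_smul] at h
    exact (le_max_right _ _).trans h
  obtain ⟨δ, hδ, h⟩ := intermediate_value_Icc (by linarith : (0 : ℝ) ≤ max 1 M)
    hcont.continuousOn ⟨hM, hlarge⟩
  exact ⟨δ, hδ.1, h⟩

/-- Lemma 3.2 of the paper: if `β : [0,∞) → [0,1]` is measurable with
`∫_0^∞ β(t) dt = 1` and finite moments of orders `n` and `n+2l` (`n ≥ 2`, `l ≥ 1`),
then there exists `δ ≥ 0` with `∫_δ^{δ+1} t^n dt = ∫_0^∞ t^n β(t) dt` and
`∫_δ^{δ+1} t^{n+2l} dt ≤ ∫_0^∞ t^{n+2l} β(t) dt`. -/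
theorem stmt_3 (n l : ℕ) (hn : 2 ≤ n) (hl : 1 ≤ l) (β : ℝ → ℝ) (hmeas : Measurable β)
    (hβ0 : ∀ t, 0 ≤ t → 0 ≤ β t) (hβ1 : ∀ t, 0 ≤ t → β t ≤ 1)
    (hβint : IntegrableOn β (Ioi (0 : ℝ)))
    (hβ1' : ∫ t in Ioi (0 : ℝ), β t = 1)
    (hmom₁ : IntegrableOn (fun t => t ^ n * β t) (Ioi (0 : ℝ)))
    (hmom₂ : IntegrableOn (fun t => t ^ (n + 2 * l) * β t) (Ioi (0 : ℝ))) :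
    ∃ δ : ℝ, 0 ≤ δ ∧
      (∫ t in δ..(δ + 1), t ^ n) = (∫ t in Ioi (0 : ℝ), t ^ n * β t) ∧
      (∫ t in δ..(δ + 1), t ^ (n + 2 * l)) ≤ ∫ t in Ioi (0 : ℝ), t ^ (n + 2 * l) * β t := by
  have h0 : n ≠ 0 := by omega
  have hlow : (∫ t in (0 : ℝ)..(0 + 1), t ^ n) ≤ ∫ t in Ioi (0 : ℝ), t ^ n * β t := by
    have hint : IntegrableOn (fun t => (t ^ n - 1) * β t) (Ioi (0 : ℝ)) := by
      simp only [sub_mul, one_mul]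
      exact hmom₁.sub hβint
    have h := intervalIntegral_le_setIntegral_mul_of_sign (φ := fun t => t ^ n - 1) le_rfl
      hβ0 hβ1 (by fun_prop) hint
      (fun t ht => sub_nonpos.2 (pow_le_one₀ ht.1.le (by simpa using ht.2)))
      (fun t ht h => sub_nonneg.2 (one_le_pow₀ (by
        by_contra hlt
        exact h ⟨ht, by linarith⟩)))
    have e1 : (∫ t in (0 : ℝ)..(0 + 1), (t ^ n - 1)) = (∫ t in (0 : ℝ)..(0 + 1), t ^ n) - 1 := by
      rw [intervalIntegral.integral_sub ((continuous_pow n).intervalIntegrable _ _) (by simp)]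
      simp
    have e2 : (∫ t in Ioi (0 : ℝ), (t ^ n - 1) * β t)
        = (∫ t in Ioi (0 : ℝ), t ^ n * β t) - 1 := by
      simp only [sub_mul, one_mul]
      rw [MeasureTheory.integral_sub hmom₁ hβint, hβ1']
    linarith
  obtain ⟨δ, hδ, hδeq⟩ := exists_intervalIntegral_pow_eq h0 hlow
  refine ⟨δ, hδ, hδeq, ?_⟩
  set m := n + 2 * l with hm
  have hn' : (0 : ℝ) < n := by positivity
  have hp : (1 : ℝ) ≤ (m : ℝ) / n := by
    rw [one_le_div hn']
    exact_mod_cast (by omega : n ≤ m)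
  have hg := convexOn_rpow hp
  have hpow : ∀ t : ℝ, 0 ≤ t → (t ^ n) ^ ((m : ℝ) / n) = t ^ m := fun t ht => by
    rw [← Real.rpow_natCast t n, ← Real.rpow_mul ht, mul_div_cancel₀ _ hn'.ne',
      Real.rpow_natCast]
  have hlt : ∀ {x y : ℝ}, 0 ≤ x → x < y → x ^ n < y ^ n := fun hx hxy =>
    pow_lt_pow_left₀ hxy hx h0
  have hδ1 : 0 ≤ δ + 1 := by linarith
  obtain ⟨A, B, hin, hout⟩ : ∃ A B : ℝ, (∀ t ∈ Ioc δ (δ + 1), t ^ m - A * t ^ n - B ≤ 0) ∧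
      ∀ t, 0 < t → t ∉ Ioc δ (δ + 1) → 0 ≤ t ^ m - A * t ^ n - B := by
    have hc := fun t (ht : 0 ≤ t) => hg.chord_sign (x := t ^ n)
      (mem_Ici.2 (pow_nonneg hδ n)) (mem_Ici.2 (pow_nonneg hδ1 n))
      (mem_Ici.2 (pow_nonneg ht n)) (hlt hδ (lt_add_one δ))
    simp only [hpow δ hδ, hpow _ hδ1] at hc
    generalize ((δ + 1) ^ m - δ ^ m) / ((δ + 1) ^ n - δ ^ n) = A at hc
    refine ⟨A, δ ^ m - A * δ ^ n, fun t ht => ?_, fun t ht h => ?_⟩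
    · have ht0 := hδ.trans ht.1.le
      have := (hc t ht0).1 (hlt hδ ht.1) (pow_le_pow_left₀ ht0 ht.2 n)
      rw [hpow t ht0] at this
      linarith
    · have := (hc t ht.le).2 (by
        by_cases h1 : t ≤ δ
        · exact Or.inl (pow_le_pow_left₀ ht.le h1 n)
        · exact Or.inr (hlt hδ1 (not_le.1 fun h2 => h ⟨not_le.1 h1, h2⟩)))
      rw [hpow t ht.le] at this
      linarith
  have hmA : IntegrableOn (fun t => A * (t ^ n * β t)) (Ioi (0 : ℝ)) := hmom₁.const_mul A
  have hB : IntegrableOn (fun t => B * β t) (Ioi (0 : ℝ)) := hβint.const_mul B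
  have hsub : IntegrableOn (fun t => t ^ m * β t - A * (t ^ n * β t)) (Ioi (0 : ℝ)) :=
    hmom₂.sub hmA
  have hexp : (fun t => (t ^ m - A * t ^ n - B) * β t)
      = fun t => t ^ m * β t - A * (t ^ n * β t) - B * β t := by
    funext t
    ring
  have h := intervalIntegral_le_setIntegral_mul_of_sign
    (φ := fun t => t ^ m - A * t ^ n - B) hδ hβ0 hβ1 (by fun_prop)
    (by rw [hexp]; exact hsub.sub hB) hin hout
  have e1 : (∫ t in δ..(δ + 1), (t ^ m - A * t ^ n - B))
      = (∫ t in δ..(δ + 1), t ^ m) - A * (∫ t in δ..(δ + 1), t ^ n) - B := by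
    rw [intervalIntegral.integral_sub (Continuous.intervalIntegrable (by fun_prop) _ _) (by simp),
      intervalIntegral.integral_sub (Continuous.intervalIntegrable (by fun_prop) _ _)
        (Continuous.intervalIntegrable (by fun_prop) _ _),
      intervalIntegral.integral_const_mul]
    simp
  have e2 : (∫ t in Ioi (0 : ℝ), (t ^ m - A * t ^ n - B) * β t)
      = (∫ t in Ioi (0 : ℝ), t ^ m * β t) - A * (∫ t in Ioi (0 : ℝ), t ^ n * β t) - B := by
    rw [hexp, MeasureTheory.integral_sub hsub hB,
      MeasureTheory.integral_sub hmom₂ hmA, MeasureTheory.integral_const_mul,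
      MeasureTheory.integral_const_mul, hβ1', mul_one]
  rw [e1, e2, hδeq] at h
  linarith
end

section
/- Let n ≥ 2 be an integer and let Ω ⊂ ℝ^n be a bounded open set with Lebesgue measure |Ω| > 0. Then I(Ω)/|Ω| ≥ (n/(n+2))·(|Ω|/ω_n)^{2/n}. -/
open MeasureTheory Set

section Bathtub

variable {E : Type*} [NormedAddCommGroup E] [MeasurableSpace E] [OpensMeasurableSpace E]

/-- Among measurable sets of a given finite measure, the centred ball minimises the integral of
the squared distance to its centre. -/
theorem setIntegral_ball_norm_sub_sq_le {μ : Measure E} {s : Set E} (hs : MeasurableSet s)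
    (a : E) {R : ℝ} (hR : 0 ≤ R) (hμ : μ (Metric.ball a R) = μ s) (hfin : μ s ≠ ⊤)
    (hint : IntegrableOn (fun x => ‖x - a‖ ^ 2) s μ)
    (hball : IntegrableOn (fun x => ‖x - a‖ ^ 2) (Metric.ball a R) μ) :
    ∫ x in Metric.ball a R, ‖x - a‖ ^ 2 ∂μ ≤ ∫ x in s, ‖x - a‖ ^ 2 ∂μ := by
  have hs' : IntegrableOn (fun _ : E => R ^ 2) s μ := integrableOn_const hfin
  have hb' : IntegrableOn (fun _ : E => R ^ 2) (Metric.ball a R) μ :=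
    integrableOn_const (hμ ▸ hfin)
  have key : ∫ x in Metric.ball a R, (‖x - a‖ ^ 2 - R ^ 2) ∂μ ≤
      ∫ x in s, (‖x - a‖ ^ 2 - R ^ 2) ∂μ := by
    rw [← integral_indicator measurableSet_ball, ← integral_indicator hs]
    refine integral_mono ((hball.sub hb').integrable_indicator measurableSet_ball)
      ((hint.sub hs').integrable_indicator hs) fun x => ?_
    by_cases hx : x ∈ Metric.ball a R
    · have hlt : ‖x - a‖ < R := by simpa [dist_eq_norm] using hx
      have := norm_nonneg (x - a)
      by_cases hxs : x ∈ s
      · simp [hx, hxs]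
      · simp only [indicator_of_mem hx, indicator_of_notMem hxs]
        nlinarith
    · have hle : R ≤ ‖x - a‖ := by simpa [dist_eq_norm] using hx
      by_cases hxs : x ∈ s
      · simp only [indicator_of_mem hxs, indicator_of_notMem hx]
        nlinarith
      · simp [hx, hxs]
  rw [integral_sub hball hb', integral_sub hint hs', setIntegral_const, setIntegral_const,
    measureReal_def, measureReal_def, hμ] at key
  linarith

end Bathtub

/-- The polar moment of inertia of a ball about its centre. -/
theorem setIntegral_ball_norm_sub_sq {E : Type*} [NormedAddCommGroup E] [NormedSpace ℝ E]
    [FiniteDimensional ℝ E] [Nontrivial E] [MeasurableSpace E] [BorelSpace E]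
    (μ : Measure E) [μ.IsAddHaarMeasure] (a : E) {R : ℝ} (hR : 0 ≤ R) :
    ∫ x in Metric.ball a R, ‖x - a‖ ^ 2 ∂μ =
      (Module.finrank ℝ E : ℝ) / (Module.finrank ℝ E + 2) * R ^ 2 *
        μ.real (Metric.ball a R) := by
  have hd : 0 < Module.finrank ℝ E := Module.finrank_pos
  have hpolar : ∫ x in Metric.ball a R, ‖x - a‖ ^ 2 ∂μ =
      ∫ x, (Iio R).indicator (fun y : ℝ => y ^ 2) ‖x‖ ∂μ := by
    rw [← integral_indicator measurableSet_ball,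
      ← integral_sub_right_eq_self (fun x => (Iio R).indicator (fun y : ℝ => y ^ 2) ‖x‖) a]
    congr 1 with x
    simp [indicator, dist_eq_norm]
  have hradial : ∫ y in Ioi (0 : ℝ), y ^ (Module.finrank ℝ E - 1) •
      (Iio R).indicator (fun y : ℝ => y ^ 2) y =
      R ^ (Module.finrank ℝ E + 2) / (Module.finrank ℝ E + 2) := by
    have : (fun y : ℝ => y ^ (Module.finrank ℝ E - 1) •
        (Iio R).indicator (fun y : ℝ => y ^ 2) y) =
        (Iio R).indicator (fun y : ℝ => y ^ (Module.finrank ℝ E + 1)) := by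
      ext y
      by_cases hy : y < R
      · simp only [indicator, mem_Iio, hy, if_true, smul_eq_mul, ← pow_add]
        congr 1
        omega
      · simp [indicator, hy]
    rw [this, setIntegral_indicator measurableSet_Iio, Ioi_inter_Iio,
      ← integral_Ioc_eq_integral_Ioo, ← intervalIntegral.integral_of_le hR, integral_pow]
    push_cast
    ring
  rw [hpolar, integral_fun_norm_addHaar, hradial, measureReal_def, measureReal_def,
    Measure.addHaar_ball μ a hR, ENNReal.toReal_mul, ENNReal.toReal_ofReal (by positivity)]
  simp only [nsmul_eq_mul, smul_eq_mul]
  ring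

/-- Inequality (B5) of Lemma 2.1 of the paper: for a bounded open set
`Ω ⊂ ℝ^n` (`n ≥ 2`) with `|Ω| > 0`, the moment of inertia
`I(Ω) = inf_{a} ∫_Ω |x−a|^2 dx` satisfies
`I(Ω)/|Ω| ≥ (n/(n+2))·(|Ω|/ω_n)^{2/n}`, where `ω_n = π^{n/2}/Γ(1+n/2)`. -/
theorem stmt_7 (n : ℕ) (hn : 2 ≤ n) (Ω : Set (EuclideanSpace ℝ (Fin n)))
    (hopen : IsOpen Ω) (hbdd : Bornology.IsBounded Ω) (hpos : 0 < volume Ω) :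
    (⨅ a : EuclideanSpace ℝ (Fin n), ∫ x in Ω, ‖x - a‖ ^ 2) / (volume Ω).toReal ≥
      ((n : ℝ) / (n + 2)) *
        ((volume Ω).toReal / (Real.pi ^ ((n : ℝ) / 2) / Real.Gamma (1 + n / 2)))
          ^ ((2 : ℝ) / n) := by
  have hn0 : (n : ℝ) ≠ 0 := by positivity
  have : Nonempty (Fin n) := ⟨⟨0, by omega⟩⟩
  have hfin : volume Ω ≠ ⊤ := hbdd.measure_lt_top.ne
  have hV : 0 < (volume Ω).toReal := ENNReal.toReal_pos hpos.ne' hfin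
  set ω : ℝ := Real.pi ^ ((n : ℝ) / 2) / Real.Gamma (1 + n / 2) with hω
  have hω0 : 0 < ω := div_pos (by positivity) (Real.Gamma_pos_of_pos (by positivity))
  set q : ℝ := (volume Ω).toReal / ω with hq
  have hq0 : 0 < q := div_pos hV hω0
  set R : ℝ := q ^ (1 / (n : ℝ)) with hRdef
  have hR : 0 ≤ R := by positivity
  have hRn : R ^ n = q := by
    rw [hRdef, ← Real.rpow_natCast, ← Real.rpow_mul hq0.le, one_div_mul_cancel hn0,
      Real.rpow_one]
  have hR2 : R ^ 2 = q ^ ((2 : ℝ) / n) := by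
    rw [hRdef, ← Real.rpow_natCast, ← Real.rpow_mul hq0.le]
    congr 1
    push_cast
    ring
  have hball (a : EuclideanSpace ℝ (Fin n)) : volume (Metric.ball a R) = volume Ω := by
    have hω' : √Real.pi ^ n / Real.Gamma (n / 2 + 1) = ω := by
      rw [hω, add_comm, Real.sqrt_eq_rpow, ← Real.rpow_natCast, ← Real.rpow_mul Real.pi_nonneg]
      congr 2
      ring
    rw [EuclideanSpace.volume_ball, Fintype.card_fin, hω', ← ENNReal.ofReal_pow hR, hRn,
      ← ENNReal.ofReal_mul hq0.le, hq, div_mul_cancel₀ _ hω0.ne', ENNReal.ofReal_toReal hfin]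
  have hint (a : EuclideanSpace ℝ (Fin n)) {s : Set (EuclideanSpace ℝ (Fin n))}
      (hs : Bornology.IsBounded s) : IntegrableOn (fun x => ‖x - a‖ ^ 2) s :=
    ((by fun_prop : Continuous fun x => ‖x - a‖ ^ 2).continuousOn.integrableOn_compact
      hs.isCompact_closure).mono_set subset_closure
  rw [ge_iff_le, le_div_iff₀ hV, ← hR2]
  refine le_ciInf fun a => ?_
  refine le_of_eq_of_le ?_ (setIntegral_ball_norm_sub_sq_le hopen.measurableSet a hR (hball a) hfin
    (hint a hbdd) (hint a Metric.isBounded_ball))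
  rw [setIntegral_ball_norm_sub_sq volume a hR, measureReal_def, hball, finrank_euclideanSpace_fin]
end

section
/- Let n ≥ 2 be an integer, let M > 0, k > 0 and σ be real numbers with 0 < σ < n, and let F : ℝ^n → ℝ be a measurable function with 0 ≤ F(ξ) ≤ M for all ξ and ∫_{ℝ^n} F(ξ) dξ = k. Then ∫_{ℝ^n} F(ξ)·|ξ|^{−σ} dξ ≤ (n/(n−σ))·(M·ω_n)^{σ/n}·k^{1−σ/n}. -/
open MeasureTheory Set

lemma pow_sub_one_mul_rpow_neg {d : ℕ} (hd : 1 ≤ d) {σ y : ℝ} (hy : 0 < y) :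
    y ^ (d - 1) * y ^ (-σ) = y ^ ((d : ℝ) - σ - 1) := by
  rw [← Real.rpow_natCast, ← Real.rpow_add hy, Nat.cast_sub hd]
  congr 1
  push_cast
  ring

section RadialPower

variable {E : Type*} [NormedAddCommGroup E] [NormedSpace ℝ E] [FiniteDimensional ℝ E]
  [MeasurableSpace E] [BorelSpace E] [Nontrivial E] (μ : Measure E) [μ.IsAddHaarMeasure]

lemma integrableOn_ball_norm_rpow_neg {σ R : ℝ} (hσ : σ < Module.finrank ℝ E) (hR : 0 ≤ R) :
    IntegrableOn (fun x : E => ‖x‖ ^ (-σ)) (Metric.ball 0 R) μ := by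
  rw [integrableOn_fun_norm_addHaar μ (f := fun y : ℝ => y ^ (-σ))]
  have h : IntegrableOn (fun y : ℝ => y ^ ((Module.finrank ℝ E : ℝ) - σ - 1)) (Ioo 0 R) :=
    ((intervalIntegrable_iff_integrableOn_Ioo_of_le hR).1
      (intervalIntegral.intervalIntegrable_rpow' (by linarith)))
  refine h.congr_fun (fun y hy => ?_) measurableSet_Ioo
  exact (pow_sub_one_mul_rpow_neg Module.finrank_pos hy.1).symm

lemma setIntegral_ball_norm_rpow_neg {σ R : ℝ} (hσ : σ < Module.finrank ℝ E) (hR : 0 ≤ R) :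
    ∫ x in Metric.ball (0 : E) R, ‖x‖ ^ (-σ) ∂μ =
      Module.finrank ℝ E * μ.real (Metric.ball 0 1) *
        (R ^ ((Module.finrank ℝ E : ℝ) - σ) / (Module.finrank ℝ E - σ)) := by
  have hd : 1 ≤ Module.finrank ℝ E := Module.finrank_pos
  have hball : ∫ x in Metric.ball (0 : E) R, ‖x‖ ^ (-σ) ∂μ =
      ∫ x : E, (Iio R).indicator (fun y : ℝ => y ^ (-σ)) ‖x‖ ∂μ := by
    rw [← integral_indicator measurableSet_ball]
    congr with x
    simp [indicator]
  have hline : ∫ y in Ioi (0 : ℝ), y ^ (Module.finrank ℝ E - 1) •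
      (Iio R).indicator (fun y : ℝ => y ^ (-σ)) y =
      ∫ y in (0 : ℝ)..R, y ^ ((Module.finrank ℝ E : ℝ) - σ - 1) := by
    rw [intervalIntegral.integral_of_le hR, integral_Ioc_eq_integral_Ioo,
      ← integral_indicator measurableSet_Ioi, ← integral_indicator measurableSet_Ioo]
    congr with y
    by_cases h0 : 0 < y <;> by_cases h1 : y < R <;>
      simp [indicator, h0, h1, pow_sub_one_mul_rpow_neg hd]
  rw [hball, integral_fun_norm_addHaar, hline, integral_rpow (Or.inl (by linarith)),
    sub_add_cancel, Real.zero_rpow (by linarith), sub_zero, nsmul_eq_mul, smul_eq_mul, mul_assoc]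

/-- Bathtub estimate: comparing a density bounded by `M` with `M` times the indicator of a
centered ball of radius `R`. -/
lemma integral_mul_norm_rpow_neg_le {M σ R : ℝ} (hσ0 : 0 ≤ σ)
    (hσ : σ < Module.finrank ℝ E) (hR : 0 < R) {F : E → ℝ} (hF : Integrable F μ)
    (hF0 : ∀ x, 0 ≤ F x) (hFM : ∀ x, F x ≤ M) :
    ∫ x, F x * ‖x‖ ^ (-σ) ∂μ ≤
      (∫ x, F x ∂μ) * R ^ (-σ) + M * (Module.finrank ℝ E * μ.real (Metric.ball 0 1) *
        (R ^ ((Module.finrank ℝ E : ℝ) - σ) / (Module.finrank ℝ E - σ))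
        - R ^ Module.finrank ℝ E * μ.real (Metric.ball 0 1) * R ^ (-σ)) := by
  have hpow := integrableOn_ball_norm_rpow_neg μ hσ hR.le
  have hconst : IntegrableOn (fun _ : E => R ^ (-σ)) (Metric.ball 0 R) μ :=
    integrableOn_const measure_ball_lt_top.ne
  have hdiff := (integrable_indicator_iff measurableSet_ball).2 (hpow.sub hconst)
  have hle : (fun x => F x * ‖x‖ ^ (-σ)) ≤ᵐ[μ] fun x => F x * R ^ (-σ) +
      M * (Metric.ball 0 R).indicator (fun x : E => ‖x‖ ^ (-σ) - R ^ (-σ)) x := by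
    filter_upwards [Measure.ae_ne μ 0] with x hx
    have hx' : 0 < ‖x‖ := norm_pos_iff.2 hx
    by_cases h : ‖x‖ < R
    · have := Real.rpow_le_rpow_of_nonpos hx' h.le (neg_nonpos.2 hσ0)
      simp only [indicator, Metric.mem_ball, dist_zero_right, h, if_true]
      nlinarith [hFM x]
    · have := Real.rpow_le_rpow_of_nonpos hR (not_lt.1 h) (neg_nonpos.2 hσ0)
      simp only [indicator, Metric.mem_ball, dist_zero_right, h, if_false]
      nlinarith [hF0 x]
  refine (integral_mono_of_nonneg (.of_forall fun x => ?_)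
    ((hF.mul_const _).add (hdiff.const_mul M)) hle).trans_eq ?_
  · exact mul_nonneg (hF0 x) (Real.rpow_nonneg (norm_nonneg x) _)
  · refine (integral_add (hF.mul_const _) (hdiff.const_mul M)).trans ?_
    rw [integral_mul_const, integral_const_mul, integral_indicator measurableSet_ball]
    congr 2
    refine (integral_sub hpow hconst).trans ?_
    rw [setIntegral_ball_norm_rpow_neg μ hσ hR.le, setIntegral_const, smul_eq_mul,
      measureReal_def μ (Metric.ball 0 R), Measure.addHaar_ball μ 0 hR.le, ENNReal.toReal_mul,
      ENNReal.toReal_ofReal (pow_nonneg hR.le _), ← measureReal_def]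

end RadialPower

/-- The bathtub-principle estimate underlying the proof of Theorem 1.4 of the
paper: if `F : ℝ^n → ℝ` is measurable with `0 ≤ F ≤ M` and `∫ F = k`, and
`0 < σ < n`, then `∫ F(ξ)·|ξ|^{−σ} dξ ≤ (n/(n−σ))·(M·ω_n)^{σ/n}·k^{1−σ/n}`,
where `ω_n = π^{n/2}/Γ(1+n/2)` is the volume of the unit ball. -/
theorem stmt_18 (n : ℕ) (hn : 2 ≤ n) (M k σ : ℝ) (hM : 0 < M) (hk : 0 < k)
    (hσ0 : 0 < σ) (hσn : σ < n)
    (F : EuclideanSpace ℝ (Fin n) → ℝ) (hmeas : Measurable F)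
    (hF0 : ∀ ξ, 0 ≤ F ξ) (hFM : ∀ ξ, F ξ ≤ M)
    (hint : ∫ ξ, F ξ = k) :
    ∫ ξ, F ξ * ‖ξ‖ ^ (-σ) ≤
      ((n : ℝ) / ((n : ℝ) - σ))
        * (M * (Real.pi ^ ((n : ℝ) / 2) / Real.Gamma (1 + n / 2))) ^ (σ / n)
        * k ^ (1 - σ / n) := by
  have hn0 : (0 : ℝ) < n := hσ0.trans hσn
  have : Nonempty (Fin n) := ⟨⟨0, by lia⟩⟩
  have hF : Integrable F := .of_integral_ne_zero (hint ▸ hk.ne')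
  set w := Real.pi ^ ((n : ℝ) / 2) / Real.Gamma (1 + n / 2) with hw
  have hw0 : 0 < w :=
    div_pos (Real.rpow_pos_of_pos Real.pi_pos _) (Real.Gamma_pos_of_pos (by positivity))
  have hvol : (volume : Measure (EuclideanSpace ℝ (Fin n))).real (Metric.ball 0 1) = w := by
    have hpi : √Real.pi ^ n = Real.pi ^ ((n : ℝ) / 2) := by
      rw [Real.sqrt_eq_rpow, ← Real.rpow_mul_natCast Real.pi_pos.le]
      congr 1
      ring
    rw [measureReal_def, EuclideanSpace.volume_ball, Fintype.card_fin, hpi,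
      add_comm ((n : ℝ) / 2), ← hw]
    simp [hw0.le]
  have hMw : 0 < M * w := mul_pos hM hw0
  have hq : 0 < k / (M * w) := div_pos hk hMw
  have hbound := integral_mul_norm_rpow_neg_le volume (R := (k / (M * w)) ^ (1 / (n : ℝ)))
    hσ0.le (by simpa using hσn) (Real.rpow_pos_of_pos hq _) hF hF0 hFM
  have hRn : ((k / (M * w)) ^ (1 / (n : ℝ))) ^ n = k / (M * w) := by
    rw [← Real.rpow_mul_natCast hq.le, one_div_mul_cancel hn0.ne', Real.rpow_one]
  have hRσ : k * ((k / (M * w)) ^ (1 / (n : ℝ))) ^ (-σ) =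
      (M * w) ^ (σ / n) * k ^ (1 - σ / n) := by
    rw [← Real.rpow_mul hq.le, show 1 / (n : ℝ) * -σ = -(σ / n) by ring,
      Real.rpow_neg hq.le, Real.div_rpow hk.le hMw.le, Real.rpow_sub hk, Real.rpow_one, inv_div]
    ring
  rw [finrank_euclideanSpace_fin, hvol, hint, sub_eq_add_neg (n : ℝ) σ,
    Real.rpow_add (Real.rpow_pos_of_pos hq _), Real.rpow_natCast, hRn, ← sub_eq_add_neg] at hbound
  refine hbound.trans_eq ?_
  rw [mul_assoc ((n : ℝ) / (n - σ)), ← hRσ]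
  have : (n : ℝ) - σ ≠ 0 := (sub_pos.2 hσn).ne'
  field_simp
  ring
end

section
/- Let M > 0 and L > 0 be real numbers, let s ≥ 0, and let b and d be real numbers with 0 ≤ b ≤ d. Define Ψ_s : [0,∞) → ℝ by Ψ_s(r) = M for 0 ≤ r ≤ s, Ψ_s(r) = M − L(r−s) for s ≤ r ≤ s + M/L, and Ψ_s(r) = 0 for r ≥ s + M/L. Let F : [0,∞) → ℝ be a decreasing, absolutely continuous function satisfying 0 ≤ F(r) ≤ M, 0 ≤ −F'(r) ≤ L for almost every r, and ∫_0^∞ r^b F(r) dr = ∫_0^∞ r^b Ψ_s(r) dr. Then ∫_0^∞ r^d F(r) dr ≥ ∫_0^∞ r^d Ψ_s(r) dr. -/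
open MeasureTheory Set

/-- If `f ≤ g` before `t` and `g ≤ f` after `t`, and `f`, `g` have the same finite `b`-th moment,
then every moment of `f` of order `d ≥ b` is at least that of `g`. -/
theorem lintegral_rpow_mul_le_of_single_crossing {b d t : ℝ} {f g : ℝ → ℝ}
    (hbd : b ≤ d) (ht : 0 ≤ t)
    (hf0 : ∀ r, 0 < r → 0 ≤ f r) (hg0 : ∀ r, 0 < r → 0 ≤ g r)
    (hlt : ∀ r, 0 < r → r < t → f r ≤ g r) (hgt : ∀ r, t < r → g r ≤ f r)
    (hf : AEMeasurable f (volume.restrict (Ioi 0)))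
    (hmom : ∫⁻ r in Ioi (0 : ℝ), ENNReal.ofReal (r ^ b * f r) =
      ∫⁻ r in Ioi (0 : ℝ), ENNReal.ofReal (r ^ b * g r))
    (hfin : ∫⁻ r in Ioi (0 : ℝ), ENNReal.ofReal (r ^ b * g r) ≠ ⊤) :
    ∫⁻ r in Ioi (0 : ℝ), ENNReal.ofReal (r ^ d * g r) ≤
      ∫⁻ r in Ioi (0 : ℝ), ENNReal.ofReal (r ^ d * f r) := by
  have hmeas : ∀ p : ℝ, AEMeasurable (fun r ↦ ENNReal.ofReal (r ^ p * f r))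
      (volume.restrict (Ioi (0 : ℝ))) := fun p ↦
    ((measurable_id.pow_const p).aemeasurable.mul hf).ennreal_ofReal
  set c : ℝ := t ^ (d - b) with hc
  have hc0 : 0 ≤ c := Real.rpow_nonneg ht _
  have key : ∫⁻ r in Ioi (0 : ℝ), (ENNReal.ofReal (r ^ d * g r) +
        ENNReal.ofReal c * ENNReal.ofReal (r ^ b * f r)) ≤
      ∫⁻ r in Ioi (0 : ℝ), (ENNReal.ofReal (r ^ d * f r) +
        ENNReal.ofReal c * ENNReal.ofReal (r ^ b * g r)) := by
    refine setLIntegral_mono' measurableSet_Ioi fun r (hr : 0 < r) ↦ ?_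
    have hb0 : 0 ≤ r ^ b := Real.rpow_nonneg hr.le _
    have hd0 : 0 ≤ r ^ d := Real.rpow_nonneg hr.le _
    have hf0 := hf0 r hr
    have hg0 := hg0 r hr
    rw [← ENNReal.ofReal_mul hc0, ← ENNReal.ofReal_mul hc0,
      ← ENNReal.ofReal_add (by positivity) (by positivity),
      ← ENNReal.ofReal_add (by positivity) (by positivity)]
    apply ENNReal.ofReal_le_ofReal
    have hsplit : r ^ d = r ^ b * r ^ (d - b) := by
      rw [← Real.rpow_add hr]
      congr 1
      ring
    have hprod : 0 ≤ (r ^ (d - b) - c) * (f r - g r) := by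
      rcases lt_trichotomy r t with h | h | h
      · exact mul_nonneg_of_nonpos_of_nonpos
          (sub_nonpos.2 (Real.rpow_le_rpow hr.le h.le (sub_nonneg.2 hbd)))
          (sub_nonpos.2 (hlt r hr h))
      · simp [hc, h]
      · exact mul_nonneg
          (sub_nonneg.2 (Real.rpow_le_rpow ht h.le (sub_nonneg.2 hbd)))
          (sub_nonneg.2 (hgt r h))
    rw [hsplit]
    linarith [mul_nonneg hb0 hprod]
  rw [lintegral_add_right' _ ((hmeas b).const_mul _), lintegral_add_left' (hmeas d),
    lintegral_const_mul' _ _ ENNReal.ofReal_ne_top,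
    lintegral_const_mul' _ _ ENNReal.ofReal_ne_top, hmom] at key
  exact (ENNReal.add_le_add_iff_right (ENNReal.mul_ne_top ENNReal.ofReal_ne_top hfin)).1 key

/-- A function on `(0, ∞)` that is bounded and vanishes beyond `e` has finite moments of
nonnegative order. -/
theorem lintegral_rpow_mul_ne_top {b e M : ℝ} {g : ℝ → ℝ} (hb : 0 ≤ b)
    (hgM : ∀ r, 0 < r → g r ≤ M) (hM : 0 ≤ M) (hge : ∀ r, 0 < r → e < r → g r = 0) :
    ∫⁻ r in Ioi (0 : ℝ), ENNReal.ofReal (r ^ b * g r) ≠ ⊤ := by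
  have hle : ∫⁻ r in Ioi (0 : ℝ), ENNReal.ofReal (r ^ b * g r) ≤
      ∫⁻ r in Ioi (0 : ℝ), (Iic e).indicator (fun _ ↦ ENNReal.ofReal (e ^ b * M)) r := by
    refine setLIntegral_mono' measurableSet_Ioi fun r (hr : 0 < r) ↦ ?_
    by_cases h : r ≤ e
    · rw [indicator_of_mem (mem_Iic.2 h)]
      refine ENNReal.ofReal_le_ofReal ?_
      calc r ^ b * g r ≤ r ^ b * M :=
            mul_le_mul_of_nonneg_left (hgM r hr) (Real.rpow_nonneg hr.le _)
        _ ≤ e ^ b * M := mul_le_mul_of_nonneg_right (Real.rpow_le_rpow hr.le h hb) hM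
    · simp [hge r hr (not_le.1 h)]
  refine ne_top_of_le_ne_top ?_ hle
  rw [lintegral_indicator_const measurableSet_Iic, Measure.restrict_apply measurableSet_Iic,
    Iic_inter_Ioi, Real.volume_Ioc]
  exact ENNReal.mul_ne_top ENNReal.ofReal_ne_top ENNReal.ofReal_ne_top

/-- Lemma 5.1 of the paper (Ilyin's comparison lemma): among all decreasing
`L`-Lipschitz (equivalently, absolutely continuous with `0 ≤ −F' ≤ L` a.e.)
functions `F` on `[0,∞)` with `0 ≤ F ≤ M` whose `b`-th moment equals that of the
trapezoidal profile `Ψ_s`, the profile `Ψ_s` minimizes every moment of order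
`d ≥ b ≥ 0`. -/
theorem stmt_19 (M L s b d : ℝ) (hM : 0 < M) (hL : 0 < L) (hs : 0 ≤ s)
    (hb : 0 ≤ b) (hbd : b ≤ d)
    (Ψ : ℝ → ℝ)
    (hΨ : ∀ r, 0 ≤ r → Ψ r =
      if r ≤ s then M else if r ≤ s + M / L then M - L * (r - s) else 0)
    (F : ℝ → ℝ)
    (hF0 : ∀ r, 0 ≤ r → 0 ≤ F r) (hFM : ∀ r, 0 ≤ r → F r ≤ M)
    (hdec : AntitoneOn F (Ici (0 : ℝ)))
    (hlip : LipschitzOnWith (Real.toNNReal L) F (Ici (0 : ℝ)))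
    (hmom : ∫⁻ r in Ioi (0 : ℝ), ENNReal.ofReal (r ^ b * F r) =
      ∫⁻ r in Ioi (0 : ℝ), ENNReal.ofReal (r ^ b * Ψ r)) :
    ∫⁻ r in Ioi (0 : ℝ), ENNReal.ofReal (r ^ d * F r) ≥
      ∫⁻ r in Ioi (0 : ℝ), ENNReal.ofReal (r ^ d * Ψ r) := by
  have hML : 0 < M / L := div_pos hM hL
  have hLM : L * (M / L) = M := mul_div_cancel₀ M hL.ne'
  have hΨ0 : ∀ r, 0 ≤ r → 0 ≤ Ψ r := by
    intro r hr
    rw [hΨ r hr]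
    split_ifs with h₁ h₂
    · exact hM.le
    · nlinarith
    · exact le_rfl
  have hΨM : ∀ r, 0 ≤ r → Ψ r ≤ M := by
    intro r hr
    rw [hΨ r hr]
    split_ifs with h₁ h₂
    · exact le_rfl
    · nlinarith
    · exact hM.le
  have hΨe : ∀ r, 0 ≤ r → s + M / L < r → Ψ r = 0 := by
    intro r hr h
    rw [hΨ r hr, if_neg (by linarith), if_neg (by linarith)]
  have hdown : ∀ r r', 0 ≤ r → r ≤ r' → r' ≤ s + M / L → F r' ≤ Ψ r' → F r ≤ Ψ r := by
    intro r r' hr hrr' hr' h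
    by_cases hrs : r ≤ s
    · rw [hΨ r hr, if_pos hrs]
      exact hFM r hr
    · rw [hΨ r' (hr.trans hrr'), if_neg (by linarith), if_pos hr'] at h
      rw [hΨ r hr, if_neg hrs, if_pos (by linarith)]
      have hdist := hlip.dist_le_mul r hr r' (hr.trans hrr')
      rw [Real.coe_toNNReal L hL.le, Real.dist_eq, Real.dist_eq, abs_sub_comm r r',
        abs_of_nonneg (sub_nonneg.2 hrr')] at hdist
      linarith [le_abs_self (F r - F r')]
  set S : Set ℝ := {r | 0 ≤ r ∧ r ≤ s + M / L ∧ F r ≤ Ψ r} with hS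
  have hSbdd : BddAbove S := ⟨s + M / L, fun r hr ↦ hr.2.1⟩
  have hS0 : (0 : ℝ) ∈ S := by
    refine ⟨le_rfl, by linarith, ?_⟩
    rw [hΨ 0 le_rfl, if_pos hs]
    exact hFM 0 le_rfl
  have ht : 0 ≤ sSup S := le_csSup hSbdd hS0
  refine lintegral_rpow_mul_le_of_single_crossing hbd ht (fun r hr ↦ hF0 r hr.le)
    (fun r hr ↦ hΨ0 r hr.le) ?_ ?_ ?_ hmom
    (lintegral_rpow_mul_ne_top hb (fun r hr ↦ hΨM r hr.le) hM.le fun r hr ↦ hΨe r hr.le)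
  · intro r hr hrt
    obtain ⟨r', hr', hlt⟩ := exists_lt_of_lt_csSup ⟨0, hS0⟩ hrt
    exact hdown r r' hr.le hlt.le hr'.2.1 hr'.2.2
  · intro r hr
    have hr0 : 0 ≤ r := ht.trans hr.le
    by_contra! h
    refine hr.not_ge (le_csSup hSbdd ⟨hr0, ?_, h.le⟩)
    by_contra! he
    linarith [hF0 r hr0, hΨe r hr0 he]
  · exact (hlip.continuousOn.mono Ioi_subset_Ici_self).aemeasurable measurableSet_Ioi
end
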